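/- arXiv:2409.07979 — 2 statements merged into one kernel-verified Lean document; each statement's English description precedes it below -/
import Mathlib

section
/- Let (X,T) be a minimal distal topological dynamical system, d ∈ ℕ, and let p_1, …, p_d be integral polynomials with p_i(0) = 0 for every 1 ≤ i ≤ d. Then there is a dense Gδ subset X_0 of X such that for each x ∈ X_0 and each neighbourhood U of x, the set N_{{p_1,…,p_d}}(x,U) = {n ∈ ℤ : T^{p_1(n)}x ∈ U, …, T^{p_d(n)}x ∈ U} is piecewise syndetic. -/
open Filter Topology Function Set

/-- Iterates of a homeomorphism indexed by `ℕ`. -/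
def hpowNat {X : Type*} [TopologicalSpace X] (T : X ≃ₜ X) : ℕ → X ≃ₜ X
  | 0 => Homeomorph.refl X
  | n + 1 => (hpowNat T n).trans T

/-- Iterates of a homeomorphism indexed by `ℤ`. -/
def hpowInt {X : Type*} [TopologicalSpace X] (T : X ≃ₜ X) : ℤ → X ≃ₜ X
  | Int.ofNat n => hpowNat T n
  | Int.negSucc n => (hpowNat T (n + 1)).symm

/-- The `n`-th iterate (`n : ℤ`) of the homeomorphism `T`, as a map. -/
def hpow {X : Type*} [TopologicalSpace X] (T : X ≃ₜ X) (n : ℤ) : X → X :=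
  ⇑(hpowInt T n)

/-- The (two-sided) orbit of `x` under the homeomorphism `T`. -/
def zorbit {X : Type*} [TopologicalSpace X] (T : X ≃ₜ X) (x : X) : Set X :=
  Set.range fun n : ℤ => hpow T n x

/-- `(X,T)` is a minimal t.d.s.: every orbit is dense. -/
def IsMinimalTDS {X : Type*} [TopologicalSpace X] (T : X ≃ₜ X) : Prop :=
  ∀ x : X, Dense (zorbit T x)

/-- A subset of `ℤ` is syndetic if it has bounded gaps. -/
def Syndetic (A : Set ℤ) : Prop :=
  ∃ N : ℕ, ∀ i : ℤ, ∃ j : ℤ, i ≤ j ∧ j ≤ i + N ∧ j ∈ A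

/-- A subset of `ℤ` is thick if it contains arbitrarily long runs of consecutive integers. -/
def Thick (A : Set ℤ) : Prop :=
  ∀ N : ℕ, ∃ i : ℤ, ∀ j : ℤ, i ≤ j → j ≤ i + N → j ∈ A

/-- A subset of `ℤ` is piecewise syndetic if it is the intersection of a syndetic set
with a thick set. -/
def PiecewiseSyndetic (A : Set ℤ) : Prop :=
  ∃ S T : Set ℤ, Syndetic S ∧ Thick T ∧ A = S ∩ T


/-- The difference operator on sequences. -/
def dOp (G : Type*) [AddCommGroup G] : (ℤ → G) →+ (ℤ → G) where
  toFun f := fun n => f (n + 1) - f n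
  map_zero' := by ext n; simp
  map_add' f g := by ext n; simp; abel

/-- Sequences of degree less than `i`. -/
def dF (G : Type*) [AddCommGroup G] : ℕ → AddSubgroup (ℤ → G)
  | 0 => ⊥
  | i + 1 => (dF G i).comap (dOp G)

section degF
variable {G : Type*} [AddCommGroup G]

lemma dF_zero_iff {f : ℤ → G} : f ∈ dF G 0 ↔ f = 0 := by
  simp [dF]

lemma dF_succ_iff {i : ℕ} {f : ℤ → G} :
    f ∈ dF G (i + 1) ↔ (fun n => f (n + 1) - f n) ∈ dF G i := Iff.rfl

lemma dF_mono_succ (i : ℕ) : dF G i ≤ dF G (i + 1) := by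
  induction i with
  | zero =>
    intro f hf
    rw [dF_zero_iff] at hf
    subst hf
    exact zero_mem _
  | succ i ih =>
    intro f hf
    rw [dF_succ_iff] at hf ⊢
    exact ih hf

lemma dF_mono {i j : ℕ} (h : i ≤ j) : dF G i ≤ dF G j :=
  monotone_nat_of_le_succ dF_mono_succ h

lemma dF_shift {i : ℕ} {f : ℤ → G} (hf : f ∈ dF G i) (m : ℤ) :
    (fun n => f (n + m)) ∈ dF G i := by
  induction i generalizing f with
  | zero =>
    rw [dF_zero_iff] at hf ⊢
    subst hf; rfl
  | succ i ih =>
    rw [dF_succ_iff] at hf ⊢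
    have := ih hf
    convert this using 2 with n
    ring_nf

lemma dF_diff {i : ℕ} {f : ℤ → G} (hf : f ∈ dF G (i + 1)) (m : ℤ) :
    (fun n => f (n + m) - f n) ∈ dF G i := by
  have hs : ∀ m : ℕ, (fun n => f (n + m) - f n) ∈ dF G i := by
    intro m
    induction m with
    | zero => simp; exact zero_mem _
    | succ m ih =>
      have h1 := dF_shift (dF_succ_iff.1 hf) (m : ℤ)
      have h2 := add_mem h1 ih
      convert h2 using 1
      ext n
      simp only [Pi.add_apply, Nat.cast_succ]
      rw [show n + ((m : ℤ) + 1) = n + m + 1 by ring]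
      abel
  obtain ⟨k, rfl | rfl⟩ := m.eq_nat_or_neg
  · exact hs k
  · have h1 := dF_shift (neg_mem (hs k)) (-(k : ℤ))
    convert h1 using 1
    ext n
    simp

lemma dF_const (a : G) {i : ℕ} (hi : 1 ≤ i) : (fun _ : ℤ => a) ∈ dF G i := by
  apply dF_mono hi
  rw [dF_succ_iff, dF_zero_iff]
  ext n; simp

lemma dF_one {f : ℤ → G} (hf : f ∈ dF G 1) (n : ℤ) : f n = f 0 := by
  have := dF_zero_iff.1 (dF_diff hf n)
  have := congrFun this 0
  simp [sub_eq_zero] at this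
  exact this

lemma dF_smul {i : ℕ} {f : ℤ → G} (hf : f ∈ dF G i) :
    (fun n => n • f n) ∈ dF G (i + 1) := by
  induction i generalizing f with
  | zero =>
    rw [dF_zero_iff] at hf
    subst hf
    simp; exact zero_mem _
  | succ i ih =>
    rw [dF_succ_iff]
    have h1 := ih (dF_succ_iff.1 hf)
    have h2 := dF_shift hf 1
    convert add_mem h1 h2 using 1
    ext n
    simp only [Pi.add_apply, smul_sub, add_smul, one_smul]
    abel

lemma dF_pow (a : G) (i : ℕ) : (fun n : ℤ => n ^ i • a) ∈ dF G (i + 1) := by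
  induction i with
  | zero => simpa using dF_const a le_rfl
  | succ i ih =>
    have := dF_smul ih
    convert this using 2 with n
    rw [smul_smul, pow_succ']

end degF


/-- Recurrence of a family of sequences for an action. -/
def PRec {G Z : Type*} [TopologicalSpace Z] (φ : G → Z → Z) (Y : Set Z)
    (F : Set (ℤ → G)) : Prop :=
  ∀ V : Set Z, IsOpen V → (V ∩ Y).Nonempty →
    ∃ n : ℤ, 1 ≤ n ∧ ∃ y ∈ Y, y ∈ V ∧ ∀ P ∈ F, φ (P n) y ∈ V

section PET
variable {G Z : Type*} [AddCommGroup G] [TopologicalSpace Z]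

lemma prec_focus (φ : G → Z → Z) (Y : Set Z)
    (hadd : ∀ a b z, φ (a + b) z = φ a (φ b z))
    (hc : ∀ g, Continuous (φ g)) (hY : ∀ g, ∀ y ∈ Y, φ g y ∈ Y)
    (hmin : ∀ V : Set Z, IsOpen V → (V ∩ Y).Nonempty →
      ∃ C : Finset G, ∀ y ∈ Y, ∃ c ∈ C, φ c y ∈ V)
    (F : Set (ℤ → G)) (hF : F.Finite) (hF0 : ∀ P ∈ F, P 0 = 0) (Q₁ : ℤ → G)
    (H : ∀ S : Set ℤ, S.Finite →
      PRec φ Y ((fun x : (ℤ → G) × ℤ => fun n => x.1 (n + x.2) - x.1 x.2 - Q₁ n) '' (F ×ˢ S))) :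
    PRec φ Y F := by
  classical
  intro V hV hVY
  obtain ⟨C, hC⟩ := hmin V hV hVY
  by_contra hfail
  have key : ∀ j : ℕ, ∃ A : Set Z, IsOpen A ∧ (A ∩ Y).Nonempty ∧ ∃ K : Finset G, K ⊆ C ∧
      K.card = j ∧ ∀ c ∈ K, ∃ N : ℤ, 1 ≤ N ∧ ∀ y ∈ A, y ∈ Y → ∀ P ∈ F, φ (c + P N) y ∈ V := by
    intro j
    induction j with
    | zero => exact ⟨V, hV, hVY, ∅, by simp, rfl, by simp⟩
    | succ j ih =>
      obtain ⟨A, hA, ⟨y, hyA, hyY⟩, K, hKC, hKj, hK⟩ := ih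
      obtain ⟨c, hcC, hcy⟩ := hC y hyY
      have hcK : c ∉ K := by
        intro hcK
        obtain ⟨N, hN, h⟩ := hK c hcK
        refine hfail ⟨N, hN, φ c y, hY _ _ hyY, hcy, fun P hP => ?_⟩
        rw [← hadd, add_comm]
        exact h y hyA hyY P hP
      choose! N hN1 hN using hK
      have hA' : IsOpen (A ∩ φ c ⁻¹' V) := hA.inter (hV.preimage (hc c))
      have hS : (insert 0 (N '' (K : Set G))).Finite := (K.finite_toSet.image N).insert 0
      obtain ⟨n, hn, w, hwY, -, hw⟩ := H _ hS _ hA' ⟨y, ⟨hyA, hcy⟩, hyY⟩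
      have hfin := hF.prod hS
      refine ⟨⋂ x ∈ F ×ˢ (insert 0 (N '' (K : Set G))),
        φ (x.1 (n + x.2) - x.1 x.2) ⁻¹' (A ∩ φ c ⁻¹' V),
        hfin.isOpen_biInter fun x _ => hA'.preimage (hc _), ⟨φ (- Q₁ n) w, ?_, hY _ _ hwY⟩,
        insert c K, ?_, ?_, ?_⟩
      · simp only [mem_iInter]
        intro x hx
        have := hw _ (mem_image_of_mem _ hx)
        rw [mem_preimage, ← hadd, ← sub_eq_add_neg]
        exact this
      · intro a ha
        rcases Finset.mem_insert.1 ha with rfl | ha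
        · exact hcC
        · exact hKC ha
      · rw [Finset.card_insert_of_notMem hcK, hKj]
      · intro a ha
        rcases Finset.mem_insert.1 ha with rfl | ha
        · refine ⟨n, hn, fun y hy hyY P hP => ?_⟩
          simp only [mem_iInter] at hy
          have := hy (P, 0) ⟨hP, mem_insert _ _⟩
          simp only [add_zero, hF0 P hP, sub_zero] at this
          rw [hadd]
          exact this.2
        · refine ⟨N a + n, by have := hN1 a ha; omega, fun y hy hyY P hP => ?_⟩
          simp only [mem_iInter] at hy
          have := hy (P, N a) ⟨hP, mem_insert_of_mem _ (mem_image_of_mem _ ha)⟩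
          have h2 := hN a ha _ this.1 (hY _ _ hyY) P hP
          rw [← hadd] at h2
          convert h2 using 2
          simp only [add_comm n]
          abel
  obtain ⟨A, -, -, K, hKC, hK, -⟩ := key (C.card + 1)
  have := Finset.card_le_card hKC
  omega

lemma prec_pet (φ : G → Z → Z) (Y : Set Z) (h0 : ∀ z, φ 0 z = z)
    (hadd : ∀ a b z, φ (a + b) z = φ a (φ b z))
    (hc : ∀ g, Continuous (φ g)) (hY : ∀ g, ∀ y ∈ Y, φ g y ∈ Y)
    (hmin : ∀ V : Set Z, IsOpen V → (V ∩ Y).Nonempty →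
      ∃ C : Finset G, ∀ y ∈ Y, ∃ c ∈ C, φ c y ∈ V)
    (M : Multiset ℕ) : ∀ L : Multiset (ℕ × (ℤ → G)), L.map Prod.fst = M →
      (∀ x ∈ L, x.2 ∈ dF G (x.1 + 1)) → ∀ F : Set (ℤ → G), F.Finite →
      (∀ P ∈ F, P 0 = 0 ∧ (P = 0 ∨ ∃ x ∈ L, P - x.2 ∈ dF G x.1)) → PRec φ Y F := by
  classical
  have wf : WellFounded (Relation.CutExpand (fun a b : ℕ => a < b)) :=
    WellFounded.cutExpand wellFounded_lt
  induction M using wf.induction with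
  | _ M ih =>
  intro L hLM hL F hF hFL
  -- remove zero
  suffices h : PRec φ Y (F \ {0}) by
    intro V hV hVY
    obtain ⟨n, hn, y, hyY, hyV, hy⟩ := h V hV hVY
    refine ⟨n, hn, y, hyY, hyV, fun P hP => ?_⟩
    by_cases hP0 : P = 0
    · subst hP0
      simpa [h0] using hyV
    · exact hy P ⟨hP, hP0⟩
  have hF' : (F \ {0}).Finite := hF.subset sdiff_subset
  have hcl : ∀ P ∈ F \ {0}, P ≠ 0 ∧ P 0 = 0 ∧ ∃ x ∈ L, P - x.2 ∈ dF G x.1 := by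
    rintro P ⟨hP, hP0⟩
    obtain ⟨h1, h2⟩ := hFL P hP
    exact ⟨hP0, h1, h2.resolve_left hP0⟩
  generalize F \ {0} = F' at hF' hcl ⊢
  clear hFL hF F
  by_cases hLe : L = 0
  · intro V hV ⟨y, hyV, hyY⟩
    refine ⟨1, le_rfl, y, hyY, hyV, fun P hP => ?_⟩
    obtain ⟨-, -, x, hx, -⟩ := hcl P hP
    simp [hLe] at hx
  obtain ⟨x, hxL, hxmin⟩ : ∃ x ∈ L, ∀ y ∈ L, x.1 ≤ y.1 := by
    have hne : L.toFinset.Nonempty := by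
      obtain ⟨a, ha⟩ := Multiset.exists_mem_of_ne_zero hLe
      exact ⟨a, by simpa using ha⟩
    obtain ⟨x, hx, h⟩ := Finset.exists_min_image L.toFinset Prod.fst hne
    exact ⟨x, by simpa using hx, fun y hy => h y (by simpa using hy)⟩
  have hmapL : L.map Prod.fst = (L.erase x).map Prod.fst + {x.1} := by
    conv_lhs => rw [← Multiset.cons_erase hxL]
    rw [Multiset.map_cons, add_comm, Multiset.singleton_add]
  by_cases hcase : ∃ P ∈ F', P - x.2 ∈ dF G x.1
  swap
  · push Not at hcase
    refine ih ((L.erase x).map Prod.fst) ?_ (L.erase x) rfl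
      (fun y hy => hL y (Multiset.mem_of_mem_erase hy)) F' hF' ?_
    · refine ⟨0, x.1, by simp, ?_⟩
      rw [← hLM, hmapL, add_zero]
    · intro P hP
      obtain ⟨h1, h2, y, hy, hPy⟩ := hcl P hP
      refine ⟨h2, Or.inr ⟨y, ?_, hPy⟩⟩
      refine (Multiset.mem_erase_of_ne ?_).2 hy
      rintro rfl
      exact hcase P hP hPy
  obtain ⟨Q₁, hQ₁, hQx⟩ := hcase
  have hcl' : ∀ P ∈ F', ∀ y ∈ L, P - y.2 ∈ dF G y.1 → P ∈ dF G (y.1 + 1) ∧ 1 ≤ y.1 := by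
    intro P hP y hy h
    have h1 : P ∈ dF G (y.1 + 1) := by
      have := add_mem (dF_mono_succ _ h) (hL y hy)
      simpa using this
    refine ⟨h1, ?_⟩
    by_contra hlt
    have h0' : y.1 = 0 := by omega
    rw [h0'] at h1
    obtain ⟨h2, h3, -⟩ := hcl P hP
    apply h2
    ext n
    rw [dF_one h1 n, h3]; rfl
  obtain ⟨hQd, hd1⟩ := hcl' Q₁ hQ₁ x hxL hQx
  refine prec_focus φ Y hadd hc hY hmin F' hF' (fun P hP => (hcl P hP).2.1) Q₁ fun S hS => ?_
  set E := ((fun x : (ℤ → G) × ℤ => fun n => x.1 (n + x.2) - x.1 x.2 - Q₁ n) '' (F' ×ˢ S)) with hE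
  have hEfin : E.Finite := (hF'.prod hS).image _
  set t : Multiset (ℕ × (ℤ → G)) :=
    (hEfin.toFinset.filter (fun f => f ∈ dF G x.1)).val.map (fun f => (x.1 - 1, f)) with ht
  refine ih (((L.erase x).map (fun y => (y.1, y.2 - Q₁)) + t).map Prod.fst) ?_ _ rfl ?_ E hEfin ?_
  · refine ⟨t.map Prod.fst, x.1, ?_, ?_⟩
    · intro a ha
      simp only [ht, Multiset.map_map, Multiset.mem_map] at ha
      obtain ⟨f, -, rfl⟩ := ha
      simp; omega
    · rw [← hLM, hmapL, Multiset.map_add, Multiset.map_map]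
      simp only [Function.comp_def]
      abel
  · intro y hy
    rcases Multiset.mem_add.1 hy with hy | hy
    · obtain ⟨z, hz, rfl⟩ := Multiset.mem_map.1 hy
      have hz' := Multiset.mem_of_mem_erase hz
      exact sub_mem (hL z hz') (dF_mono (by have := hxmin z hz'; omega) hQd)
    · obtain ⟨f, hf, rfl⟩ := Multiset.mem_map.1 hy
      have hf2 := (Finset.mem_filter.1 hf).2
      simp only
      rwa [Nat.sub_add_cancel hd1]
  · rintro f hfE
    have hfE' := hfE
    obtain ⟨⟨P, N⟩, ⟨hP, hN⟩, rfl⟩ := hfE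
    simp only at hP hN hfE' ⊢
    obtain ⟨hP0, hP00, y, hyL, hPy⟩ := hcl P hP
    obtain ⟨hPd, hy1⟩ := hcl' P hP y hyL hPy
    refine ⟨by simp [(hcl Q₁ hQ₁).2.1], Or.inr ?_⟩
    have hQy : (fun n => P (n + N) - P N) - y.2 ∈ dF G y.1 := by
      have := sub_mem (add_mem (dF_diff hPd N) hPy) (dF_const (P N) hy1)
      convert this using 1
      ext n
      simp only [Pi.sub_apply, Pi.add_apply]
      abel
    by_cases hyx : y = x
    · subst hyx
      refine ⟨(y.1 - 1, fun n => P (n + N) - P N - Q₁ n), ?_, ?_⟩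
      · refine Multiset.mem_add.2 (Or.inr (Multiset.mem_map.2 ⟨_, ?_, rfl⟩))
        refine Finset.mem_filter.2 ⟨by simpa using hfE', ?_⟩
        have := sub_mem hQy hQx
        convert this using 1
        ext n
        simp only [Pi.sub_apply]
        abel
      · simp
    · refine ⟨(y.1, y.2 - Q₁), ?_, ?_⟩
      · exact Multiset.mem_add.2 (Or.inl (Multiset.mem_map.2
          ⟨y, (Multiset.mem_erase_of_ne hyx).2 hyL, rfl⟩))
      · convert hQy using 1
        ext n
        simp only [Pi.sub_apply]
        abel

lemma prec_poly (φ : G → Z → Z) (Y : Set Z) (h0 : ∀ z, φ 0 z = z)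
    (hadd : ∀ a b z, φ (a + b) z = φ a (φ b z))
    (hc : ∀ g, Continuous (φ g)) (hY : ∀ g, ∀ y ∈ Y, φ g y ∈ Y)
    (hmin : ∀ V : Set Z, IsOpen V → (V ∩ Y).Nonempty →
      ∃ C : Finset G, ∀ y ∈ Y, ∃ c ∈ C, φ c y ∈ V)
    {ι : Type*} [Fintype ι] (P : ι → ℤ → G) (k : ℕ) (hP : ∀ i, P i ∈ dF G k)
    (hP0 : ∀ i, P i 0 = 0) : PRec φ Y (range P) := by
  refine prec_pet φ Y h0 hadd hc hY hmin _
    (Finset.univ.val.map (fun i => (k, P i))) rfl ?_ _ (finite_range P) ?_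
  · intro x hx
    obtain ⟨i, -, rfl⟩ := Multiset.mem_map.1 hx
    exact dF_mono_succ _ (hP i)
  · rintro _ ⟨i, rfl⟩
    refine ⟨hP0 i, Or.inr ⟨(k, P i), Multiset.mem_map.2 ⟨i, by simp, rfl⟩, ?_⟩⟩
    simp

end PET


/-- Windows of bounded gaps of arbitrary length. -/
def Win (A : Set ℤ) : Prop :=
  ∃ g : ℕ, ∀ L : ℕ, ∃ i : ℤ, ∀ k : ℤ, i ≤ k → k ≤ i + L → ∃ j, k ≤ j ∧ j ≤ k + g ∧ j ∈ A

lemma Win.mono {A B : Set ℤ} (h : A ⊆ B) (hA : Win A) : Win B := by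
  obtain ⟨g, hg⟩ := hA
  refine ⟨g, fun L => ?_⟩
  obtain ⟨i, hi⟩ := hg L
  refine ⟨i, fun k h1 h2 => ?_⟩
  obtain ⟨j, h3, h4, h5⟩ := hi k h1 h2
  exact ⟨j, h3, h4, h h5⟩

lemma Win.ps {A : Set ℤ} (hA : Win A) : PiecewiseSyndetic A := by
  obtain ⟨g, hg⟩ := hA
  choose I hI using hg
  let Th : Set ℤ := A ∪ {k | ∃ L : ℕ, I L ≤ k ∧ k ≤ I L + L}
  refine ⟨A ∪ Thᶜ, Th, ⟨g, fun i => ?_⟩, fun N => ⟨I N, fun j h1 h2 => Or.inr ⟨N, h1, h2⟩⟩, ?_⟩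
  · by_cases hi : i ∈ Th
    · rcases hi with hi | ⟨L, h1, h2⟩
      · exact ⟨i, le_rfl, by omega, Or.inl hi⟩
      · obtain ⟨j, h3, h4, h5⟩ := hI L i h1 h2
        exact ⟨j, h3, h4, Or.inl h5⟩
    · exact ⟨i, le_rfl, by omega, Or.inr hi⟩
  · ext k
    constructor
    · intro h
      exact ⟨Or.inl h, Or.inl h⟩
    · rintro ⟨h | h, h'⟩
      · exact h
      · exact absurd h' h

section hpowLemmas
variable {X : Type*} [TopologicalSpace X] (T : X ≃ₜ X)

lemma hpow_zero (x : X) : hpow T 0 x = x := rfl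

lemma hpowNat_succ (n : ℕ) (x : X) : hpowNat T (n + 1) x = T (hpowNat T n x) := rfl

lemma hpow_succ (n : ℤ) (x : X) : hpow T (n + 1) x = T (hpow T n x) := by
  cases n with
  | ofNat n => rfl
  | negSucc n =>
    cases n with
    | zero =>
      change x = T ((hpowNat T 1).symm x)
      exact ((hpowNat T 1).apply_symm_apply x).symm
    | succ n =>
      change (hpowNat T (n + 1)).symm x = T ((hpowNat T (n + 1 + 1)).symm x)
      rw [Homeomorph.symm_apply_eq]
      have key : ∀ (m : ℕ) (y : X), hpowNat T m (T y) = T (hpowNat T m y) := by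
        intro m y
        induction m with
        | zero => rfl
        | succ m ih => rw [hpowNat_succ, hpowNat_succ, ih]
      rw [key, ← hpowNat_succ, Homeomorph.apply_symm_apply]

lemma hpow_pred (n : ℤ) (x : X) : hpow T (n - 1) x = T.symm (hpow T n x) := by
  have := hpow_succ T (n - 1) x
  rw [sub_add_cancel] at this
  rw [this, Homeomorph.symm_apply_apply]

lemma hpow_add (a b : ℤ) (x : X) : hpow T (a + b) x = hpow T a (hpow T b x) := by
  induction a using Int.induction_on with
  | zero => simp [hpow_zero]
  | succ n ih => rw [hpow_succ, ← ih, ← hpow_succ]; congr 1; ring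
  | pred n ih => rw [hpow_pred, ← ih, ← hpow_pred]; congr 1; ring

lemma hpow_continuous (n : ℤ) : Continuous (hpow T n) := (hpowInt T n).continuous

end hpowLemmas

/-- Closed nonempty invariant sets for a family of maps. -/
def InvS {Z ι : Type*} [TopologicalSpace Z] (α : ι → Z → Z) (M : Set Z) : Prop :=
  IsClosed M ∧ M.Nonempty ∧ ∀ i, ∀ z ∈ M, α i z ∈ M

/-- Minimal sets for a family of maps. -/
def MinS {Z ι : Type*} [TopologicalSpace Z] (α : ι → Z → Z) (M : Set Z) : Prop :=
  InvS α M ∧ ∀ M', InvS α M' → M' ⊆ M → M' = M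

section minimality
variable {Z ι : Type*} [TopologicalSpace Z] [CompactSpace Z] (α : ι → Z → Z)

lemma exists_minS {M : Set Z} (hM : InvS α M) : ∃ M', M' ⊆ M ∧ MinS α M' := by
  obtain ⟨M', hM', hmin⟩ := zorn_superset_nonempty {N | InvS α N} (by
    intro c hc hchain hne
    refine ⟨⋂₀ c, ⟨isClosed_sInter fun s hs => (hc hs).1, ?_, ?_⟩, fun s hs => sInter_subset_of_mem hs⟩
    · have : Nonempty c := hne.to_subtype
      refine IsCompact.nonempty_sInter_of_directed_nonempty_isCompact_isClosed
        (fun a ha b hb => (hchain.total ha hb).elim (fun h => ⟨a, ha, subset_rfl, h⟩)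
          (fun h => ⟨b, hb, h, subset_rfl⟩))
        (fun s hs => (hc hs).2.1) (fun s hs => (hc hs).1.isCompact) (fun s hs => (hc hs).1)
    · intro i z hz s hs
      exact (hc hs).2.2 i z (hz s hs)) M hM
  exact ⟨M', hM', hmin.prop, fun N hN hNM => hmin.eq_of_subset hN hNM⟩

variable {α}

lemma MinS.exists_mem {M : Set Z} (hM : MinS α M) (hid : ∃ i, ∀ z, α i z = z)
    (hcomp : ∀ i j, ∃ k, ∀ z, α i (α j z) = α k z) (hc : ∀ i, Continuous (α i))
    {V : Set Z} (hV : IsOpen V) (hVM : (V ∩ M).Nonempty) (y : Z) (hy : y ∈ M) :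
    ∃ i, α i y ∈ V := by
  by_contra hcon
  push Not at hcon
  have : {y ∈ M | ∀ i, α i y ∉ V} = M := by
    refine hM.2 _ ⟨?_, ⟨y, hy, hcon⟩, ?_⟩ (fun z hz => hz.1)
    · have : {y ∈ M | ∀ i, α i y ∉ V} = M ∩ ⋂ i, (α i ⁻¹' V)ᶜ := by
        ext z; simp
      rw [this]
      exact hM.1.1.inter (isClosed_iInter fun i => (hV.preimage (hc i)).isClosed_compl)
    · rintro j z ⟨hz, hz'⟩
      refine ⟨hM.1.2.2 j z hz, fun i => ?_⟩
      obtain ⟨k, hk⟩ := hcomp i j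
      rw [hk]
      exact hz' k
  obtain ⟨v, hvV, hvM⟩ := hVM
  obtain ⟨i, hi⟩ := hid
  rw [← this] at hvM
  apply hvM.2 i
  rwa [hi]

lemma MinS.exists_finset {M : Set Z} (hM : MinS α M) (hid : ∃ i, ∀ z, α i z = z)
    (hcomp : ∀ i j, ∃ k, ∀ z, α i (α j z) = α k z) (hc : ∀ i, Continuous (α i))
    {V : Set Z} (hV : IsOpen V) (hVM : (V ∩ M).Nonempty) :
    ∃ C : Finset ι, ∀ y ∈ M, ∃ i ∈ C, α i y ∈ V := by
  obtain ⟨C, hC⟩ := hM.1.1.isCompact.elim_finite_subcover (fun i => α i ⁻¹' V)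
    (fun i => hV.preimage (hc i)) (fun y hy => by
      obtain ⟨i, hi⟩ := hM.exists_mem hid hcomp hc hV hVM y hy
      exact mem_iUnion.2 ⟨i, hi⟩)
  refine ⟨C, fun y hy => ?_⟩
  have := hC hy
  simp only [mem_iUnion] at this
  obtain ⟨i, hi, h⟩ := this
  exact ⟨i, hi, h⟩

lemma MinS.image [T2Space Z] {M : Set Z} (hM : MinS α M) (b : Z → Z) (hb : Continuous b)
    (h1 : ∀ i, ∃ j, ∀ z, α i (b z) = b (α j z)) (h2 : ∀ j, ∃ i, ∀ z, α i (b z) = b (α j z)) :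
    MinS α (b '' M) := by
  refine ⟨⟨(hM.1.1.isCompact.image hb).isClosed, hM.1.2.1.image b, ?_⟩, ?_⟩
  · rintro i _ ⟨z, hz, rfl⟩
    obtain ⟨j, hj⟩ := h1 i
    exact ⟨α j z, hM.1.2.2 j z hz, (hj z).symm⟩
  · intro N hN hNM
    apply subset_antisymm hNM
    have : M ∩ b ⁻¹' N = M := by
      refine hM.2 _ ⟨hM.1.1.inter (hN.1.preimage hb), ?_, ?_⟩ inter_subset_left
      · obtain ⟨w, hw⟩ := hN.2.1
        obtain ⟨z, hz, rfl⟩ := hNM hw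
        exact ⟨z, hz, hw⟩
      · rintro j z ⟨hz, hz'⟩
        refine ⟨hM.1.2.2 j z hz, ?_⟩
        obtain ⟨i, hi⟩ := h2 j
        rw [mem_preimage, ← hi]
        exact hN.2.2 i _ hz'
    rintro _ ⟨z, hz, rfl⟩
    rw [← this] at hz
    exact hz.2

end minimality


/-- The action on the big product space. -/
def zact {X : Type*} (n : ℤ) (g : ℤ → ℤ) (z : (ℤ → ℤ) → X) : (ℤ → ℤ) → X :=
  fun f => z (fun t => f (t + n) + g t)

/-- Points of the big product space coming from a point of `X`. -/
def ztheta {X : Type*} [TopologicalSpace X] (T : X ≃ₜ X) (x : ℤ × X) : (ℤ → ℤ) → X :=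
  fun f => hpow T (f x.1) x.2

/-- The closed set generated by the points `ztheta`. -/
def zOm {X : Type*} [TopologicalSpace X] (T : X ≃ₜ X) : Set ((ℤ → ℤ) → X) :=
  closure (range (ztheta T))

/-- The action of shifts and sequences of degree less than `k`. -/
def zA (X : Type*) (k : ℕ) (x : ℤ × dF ℤ k) : ((ℤ → ℤ) → X) → ((ℤ → ℤ) → X) :=
  zact x.1 x.2.1

section space
variable {X : Type*}

lemma zact_zact (n m : ℤ) (g h : ℤ → ℤ) (z : (ℤ → ℤ) → X) :
    zact n g (zact m h z) = zact (n + m) (fun t => g (t + m) + h t) z := by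
  ext f
  simp only [zact]
  congr 1
  ext t
  rw [show t + m + n = t + (n + m) by ring]
  ring

lemma zact_id (z : (ℤ → ℤ) → X) : zact 0 (fun _ => 0) z = z := by
  ext f
  simp [zact]

lemma zact_congr {n m : ℤ} {g h : ℤ → ℤ} (h1 : n = m) (h2 : ∀ t, g t = h t)
    (z : (ℤ → ℤ) → X) : zact n g z = zact m h z := by
  rw [h1, funext h2]

lemma zA_id (k : ℕ) : ∃ i, ∀ z, zA X k i z = z :=
  ⟨(0, 0), fun z => zact_id z⟩

lemma zA_comp (k : ℕ) (i j : ℤ × dF ℤ k) : ∃ l, ∀ z, zA X k i (zA X k j z) = zA X k l z :=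
  ⟨(i.1 + j.1, ⟨_, add_mem (dF_shift i.2.2 j.1) j.2.2⟩), fun _ => zact_zact _ _ _ _ _⟩

variable [TopologicalSpace X]

lemma zact_continuous (n : ℤ) (g : ℤ → ℤ) : Continuous (zact (X := X) n g) :=
  continuous_pi fun _ => continuous_apply _

lemma zA_continuous (k : ℕ) (i : ℤ × dF ℤ k) : Continuous (zA X k i) := zact_continuous _ _

lemma zA_descend_one [CompactSpace X] [T2Space X] {k : ℕ} {M : Set ((ℤ → ℤ) → X)}
    (hM : MinS (zA X (k + 1)) M)
    {V : Set ((ℤ → ℤ) → X)} (hV : IsOpen V) (hVM : (V ∩ M).Nonempty) :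
    ∃ M', M' ⊆ M ∧ MinS (zA X k) M' ∧ (V ∩ M').Nonempty := by
  have hinv : InvS (zA X k) M := ⟨hM.1.1, hM.1.2.1, fun i z hz =>
    hM.1.2.2 (i.1, ⟨i.2.1, dF_mono_succ k i.2.2⟩) z hz⟩
  obtain ⟨N, hNM, hN⟩ := exists_minS (zA X k) hinv
  obtain ⟨y, hy⟩ := hN.1.2.1
  obtain ⟨⟨n, g, hg⟩, hi⟩ :=
    hM.exists_mem (zA_id _) (zA_comp _) (zA_continuous _) hV hVM y (hNM hy)
  refine ⟨zact n g '' N, ?_, ?_, ⟨_, hi, y, hy, rfl⟩⟩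
  · rintro _ ⟨z, hz, rfl⟩
    exact hM.1.2.2 (n, ⟨g, hg⟩) z (hNM hz)
  · refine hN.image _ (zact_continuous _ _) ?_ ?_
    · rintro ⟨m, h', hh'⟩
      refine ⟨(m, ⟨fun t => h' (t + n) - (g (t + m) - g t),
        sub_mem (dF_shift hh' n) (dF_diff hg m)⟩), fun z => ?_⟩
      simp only [zA, zact_zact]
      exact zact_congr (by ring) (fun t => by ring) z
    · rintro ⟨m, h, hh⟩
      refine ⟨(m, ⟨fun t => (g (t + -n + m) - g (t + -n)) + h (t + -n),
        add_mem (dF_shift (dF_diff hg m) (-n)) (dF_shift hh (-n))⟩), fun z => ?_⟩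
      simp only [zA, zact_zact]
      refine zact_congr (by ring) (fun t => ?_) z
      simp only [add_neg_cancel_right]
      ring

lemma zA_descend [CompactSpace X] [T2Space X] (j k : ℕ) : ∀ {M : Set ((ℤ → ℤ) → X)},
    MinS (zA X (k + j)) M →
    ∀ {V : Set ((ℤ → ℤ) → X)}, IsOpen V → (V ∩ M).Nonempty →
    ∃ M', M' ⊆ M ∧ MinS (zA X k) M' ∧ (V ∩ M').Nonempty := by
  induction j with
  | zero => intro M hM V hV hVM; exact ⟨M, subset_rfl, hM, hVM⟩
  | succ j ih =>
    intro M hM V hV hVM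
    obtain ⟨N, hNM, hN, hVN⟩ := zA_descend_one (k := k + j) hM hV hVM
    obtain ⟨N', h1, h2, h3⟩ := ih hN hV hVN
    exact ⟨N', h1.trans hNM, h2, h3⟩

variable (T : X ≃ₜ X)

lemma zact_ztheta (n : ℤ) (g : ℤ → ℤ) (x : ℤ × X) :
    zact n g (ztheta T x) = ztheta T (x.1 + n, hpow T (g x.1) x.2) := by
  ext f
  simp only [zact, ztheta, hpow_add]

lemma zOm_inv (n : ℤ) (g : ℤ → ℤ) {z} (hz : z ∈ zOm T) : zact n g z ∈ zOm T := by
  refine map_mem_closure (zact_continuous n g) hz ?_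
  rintro _ ⟨x, rfl⟩
  exact ⟨_, (zact_ztheta T n g x).symm⟩

lemma zOm_invS [Nonempty X] (k : ℕ) : InvS (zA X k) (zOm T) :=
  ⟨isClosed_closure, (range_nonempty _).closure, fun _ _ hz => zOm_inv T _ _ hz⟩

lemma zOm_const [T2Space X] {z} (hz : z ∈ zOm T) (f : ℤ → ℤ) (c : ℤ) :
    z (fun t => f t + c) = hpow T c (z f) := by
  have hcl : IsClosed {z : (ℤ → ℤ) → X | z (fun t => f t + c) = hpow T c (z f)} :=
    isClosed_eq (continuous_apply _) ((hpow_continuous T c).comp (continuous_apply _))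
  refine closure_minimal ?_ hcl hz
  rintro _ ⟨x, rfl⟩
  simp only [ztheta, mem_ofPred_eq]
  rw [← hpow_add, add_comm]

end space

lemma rat_mul_int (a : ℚ) (M : ℤ) (h : (a.den : ℤ) ∣ M) : ∃ b : ℤ, (b : ℚ) = a * M := by
  obtain ⟨c, rfl⟩ := h
  refine ⟨a.num * c, ?_⟩
  push_cast
  rw [← mul_assoc, Rat.mul_den_eq_num]

lemma poly_clear (d : ℕ) (p : Fin d → ℤ → ℤ)
    (hp : ∀ i, p i 0 = 0 ∧ ∃ q : Polynomial ℚ, ∀ n : ℤ, (p i n : ℚ) = q.eval (n : ℚ)) :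
    ∃ m : ℤ, 1 ≤ m ∧ ∃ k : ℕ, ∃ A : Fin d → ℕ → ℤ, ∀ i n,
      p i (m * n) = ∑ j ∈ Finset.range k, A i j * n ^ j := by
  choose hp0 q hq using hp
  set k := 1 + ∑ i, (q i).natDegree with hk
  set m : ℕ := ∏ i, ∏ j ∈ Finset.range k, ((q i).coeff j).den with hm
  have hdvd : ∀ i, ∀ j ∈ Finset.range k, (((q i).coeff j).den : ℤ) ∣ (m : ℤ) := by
    intro i j hj
    refine Int.natCast_dvd_natCast.2 ?_
    exact (Finset.dvd_prod_of_mem _ hj).trans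
      (Finset.dvd_prod_of_mem (fun i => ∏ j ∈ Finset.range k, ((q i).coeff j).den)
        (Finset.mem_univ i))
  have hA : ∀ i j, ∃ b : ℤ, j ∈ Finset.range k → (b : ℚ) = (q i).coeff j * (m : ℚ) ^ j := by
    intro i j
    by_cases hj : j ∈ Finset.range k
    · cases j with
      | zero =>
        refine ⟨0, fun _ => ?_⟩
        have := hq i 0
        rw [hp0] at this
        simp [Polynomial.coeff_zero_eq_eval_zero] at this ⊢
        exact this
      | succ j =>
        obtain ⟨b, hb⟩ := rat_mul_int ((q i).coeff (j + 1)) m (hdvd i _ hj)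
        refine ⟨b * m ^ j, fun _ => ?_⟩
        push_cast
        rw [hb, pow_succ]
        push_cast
        ring
    · exact ⟨0, fun h => absurd h hj⟩
  choose A hA using hA
  refine ⟨m, ?_, k, A, fun i n => ?_⟩
  · have : 0 < m := Finset.prod_pos fun i _ => Finset.prod_pos fun j _ => Rat.den_pos _
    omega
  · have hdeg : (q i).natDegree < k := by
      have := Finset.single_le_sum (f := fun i => (q i).natDegree) (fun i _ => Nat.zero_le _)
        (Finset.mem_univ i)
      omega
    have : ((p i (m * n) : ℤ) : ℚ) = ((∑ j ∈ Finset.range k, A i j * n ^ j : ℤ) : ℚ) := by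
      rw [hq, Polynomial.eval_eq_sum_range' hdeg]
      push_cast
      refine Finset.sum_congr rfl fun j hj => ?_
      rw [hA i j hj]
      ring
    exact_mod_cast this

lemma step5 {X : Type*} [TopologicalSpace X] [CompactSpace X] [T2Space X] [Nonempty X]
    (T : X ≃ₜ X) (hT : IsMinimalTDS T) (d : ℕ) (p : Fin d → ℤ → ℤ)
    (hp : ∀ i, p i 0 = 0 ∧ ∃ q : Polynomial ℚ, ∀ n : ℤ, (p i n : ℚ) = q.eval (n : ℚ))
    (U : Set X) (hU : IsOpen U) (hUne : U.Nonempty) :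
    ∃ E : ℤ, 1 ≤ E ∧ ∃ M : Set ((ℤ → ℤ) → X), M ⊆ zOm T ∧ MinS (zA X 1) M ∧
      ∃ z ∈ M, z (fun _ => 0) ∈ U ∧ ∀ i, z (fun t => p i (E * t)) ∈ U := by
  obtain ⟨m, hm, k, A, hA⟩ := poly_clear d p hp
  obtain ⟨M, hMO, hM⟩ := exists_minS _ (zOm_invS T (1 + k))
  let φ : dF ℤ (1 + k) → ((ℤ → ℤ) → X) → ((ℤ → ℤ) → X) := fun g => zact 0 g.1
  have hφM : InvS φ M := ⟨hM.1.1, hM.1.2.1, fun g z hz => hM.1.2.2 (0, g) z hz⟩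
  obtain ⟨Y, hYM, hY⟩ := exists_minS φ hφM
  have h0 : ∀ z, φ 0 z = z := fun z => zact_id z
  have hadd : ∀ a b z, φ (a + b) z = φ a (φ b z) := by
    intro a b z
    simp only [φ, zact_zact]
    refine zact_congr (by ring) (fun t => ?_) z
    simp
  have hc : ∀ g, Continuous (φ g) := fun g => zact_continuous _ _
  have hmin : ∀ V : Set ((ℤ → ℤ) → X), IsOpen V → (V ∩ Y).Nonempty →
      ∃ C : Finset (dF ℤ (1 + k)), ∀ y ∈ Y, ∃ c ∈ C, φ c y ∈ V := fun V hV hVY =>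
    hY.exists_finset ⟨0, h0⟩ (fun i j => ⟨i + j, fun z => (hadd i j z).symm⟩) hc hV hVY
  let B : Fin d → ℕ → dF ℤ (1 + k) := fun i j =>
    if h : j < k then ⟨fun t => t ^ j • A i j, dF_mono (by omega) (dF_pow (A i j) j)⟩ else 0
  have hB : ∀ i j, j < k → ∀ t, (B i j).1 t = t ^ j * A i j := by
    intro i j hj t
    simp [B, hj]
  let P : Fin d → ℤ → dF ℤ (1 + k) := fun i => ∑ j ∈ Finset.range k, fun e => e ^ j • B i j
  have hPv : ∀ i e t, (P i e).1 t = p i (m * (e * t)) := by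
    intro i e t
    simp only [P, hA, Finset.sum_apply]
    rw [AddSubgroup.val_finsetSum, Finset.sum_apply]
    refine Finset.sum_congr rfl fun j hj => ?_
    rw [AddSubgroup.coe_zsmul, Pi.smul_apply, hB i j (Finset.mem_range.1 hj), smul_eq_mul]
    ring
  have hP : ∀ i, P i ∈ dF (dF ℤ (1 + k)) k := by
    intro i
    refine sum_mem fun j hj => ?_
    exact dF_mono (Finset.mem_range.1 hj) (dF_pow (B i j) j)
  have hP0 : ∀ i, P i 0 = 0 := by
    intro i
    ext t
    rw [hPv]
    simp [(hp i).1]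
  have hrec := prec_poly φ Y h0 hadd hc (fun g y hy => hY.1.2.2 g y hy) hmin P k hP hP0
  have hV : IsOpen {z : (ℤ → ℤ) → X | z (fun _ => 0) ∈ U} := hU.preimage (continuous_apply _)
  obtain ⟨e, he, y, hyY, hyV, hy⟩ := hrec _ hV (by
    obtain ⟨y, hy⟩ := hY.1.2.1
    obtain ⟨_, hn, n, rfl⟩ := (hT (y fun _ => 0)).exists_mem_open hU hUne |>.imp fun _ h => h.symm
    refine ⟨φ ⟨fun _ => n, dF_const n (by omega)⟩ y, ?_, hY.1.2.2 _ y hy⟩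
    have := zOm_const T (hMO (hYM hy)) (fun _ => 0) n
    simp only [φ, zact, mem_ofPred_eq]
    rw [this]
    exact hn)
  have hme : 1 ≤ m * e := by nlinarith
  refine ⟨m * e, hme, ?_⟩
  have hO : IsOpen {z : (ℤ → ℤ) → X | z (fun _ => 0) ∈ U ∧ ∀ i, z (fun t => p i (m * e * t)) ∈ U} := by
    simp only [ofPred_and, ofPred_forall]
    exact hV.inter (isOpen_iInter_of_finite fun i => hU.preimage (continuous_apply _))
  obtain ⟨M₁, hM₁M, hM₁, z, hzO, hz⟩ := zA_descend k 1 hM hO ⟨y, ⟨hyV, fun i => by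
    have := hy (P i) ⟨i, rfl⟩
    simp only [φ, zact, mem_ofPred_eq, hPv, zero_add] at this
    simpa only [mul_assoc] using this⟩, hYM hyY⟩
  exact ⟨M₁, hM₁M.trans hMO, hM₁, z, hz, hzO.1, hzO.2⟩


/-- Points with a long window of returns. -/
def zW {X : Type*} [TopologicalSpace X] (T : X ≃ₜ X) {d : ℕ} (p : Fin d → ℤ → ℤ) (U : Set X)
    (E : ℤ) (N L : ℕ) : Set X :=
  {x | ∃ a : ℤ, ∀ n ∈ Finset.Icc (0 : ℤ) L, ∃ j ∈ Finset.Icc (-(N : ℤ)) N,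
    ∀ i, hpow T (p i (E * (a + n + j))) x ∈ U}

/-- Points of the big space with syndetic returns. -/
def zK {X : Type*} [TopologicalSpace X] (T : X ≃ₜ X) {d : ℕ} (p : Fin d → ℤ → ℤ) (U : Set X)
    (E : ℤ) (N : ℕ) : Set ((ℤ → ℤ) → X) :=
  {z | z ∈ zOm T ∧ z (fun _ => 0) ∈ closure U ∧ ∀ n : ℤ, ∃ j ∈ Finset.Icc (-(N : ℤ)) N,
    ∀ i, z (fun t => p i (E * (t + n + j))) ∈ closure U}

lemma zK_closed {X : Type*} [TopologicalSpace X] (T : X ≃ₜ X) {d : ℕ} (p : Fin d → ℤ → ℤ)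
    (U : Set X) (E : ℤ) (N : ℕ) : IsClosed (zK T p U E N) := by
  have : zK T p U E N = zOm T ∩ ((fun z => z (fun _ => 0)) ⁻¹' closure U ∩ ⋂ n : ℤ,
      ⋃ j ∈ Finset.Icc (-(N : ℤ)) N, ⋂ i : Fin d,
        (fun z : (ℤ → ℤ) → X => z (fun t => p i (E * (t + n + j)))) ⁻¹' closure U) := by
    ext z
    simp [zK]
    tauto
  rw [this]
  refine isClosed_closure.inter ((isClosed_closure.preimage (continuous_apply _)).inter
    (isClosed_iInter fun n => isClosed_biUnion_finset fun j _ => isClosed_iInter fun i =>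
      isClosed_closure.preimage (continuous_apply _)))

lemma step6 {X : Type*} [TopologicalSpace X] [CompactSpace X] [T2Space X] [Nonempty X]
    (T : X ≃ₜ X) (hT : IsMinimalTDS T) (d : ℕ) (p : Fin d → ℤ → ℤ)
    (hp : ∀ i, p i 0 = 0 ∧ ∃ q : Polynomial ℚ, ∀ n : ℤ, (p i n : ℚ) = q.eval (n : ℚ))
    (U : Set X) (hU : IsOpen U) (hUne : U.Nonempty) :
    ∃ E : ℤ, 1 ≤ E ∧ ∀ x, ∃ c : ℤ, ∃ N : ℕ,
      hpow T c x ∈ (fun z : (ℤ → ℤ) → X => z (fun _ => 0)) '' zK T p U E N := by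
  obtain ⟨E, hE, M, hMO, hM, z₀, hz₀M, hz₀U, hz₀⟩ := step5 T hT d p hp U hU hUne
  refine ⟨E, hE, fun x => ?_⟩
  have hconst : ∀ c : ℤ, ∀ z ∈ M, zact 0 (fun _ => c) z ∈ M := fun c z hz =>
    hM.1.2.2 (0, ⟨fun _ => c, dF_const c le_rfl⟩) z hz
  have hval : ∀ c : ℤ, ∀ z ∈ M, zact 0 (fun _ => c) z (fun _ => 0) = hpow T c (z fun _ => 0) :=
    fun c z hz => zOm_const T (hMO hz) (fun _ => 0) c
  -- evaluation at zero is onto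
  have hsurj : ∃ z ∈ M, z (fun _ => 0) = x := by
    have hcl : IsClosed ((fun z : (ℤ → ℤ) → X => z (fun _ => 0)) '' M) :=
      (hM.1.1.isCompact.image (continuous_apply _)).isClosed
    have hd : zorbit T (z₀ fun _ => 0) ⊆ (fun z : (ℤ → ℤ) → X => z (fun _ => 0)) '' M := by
      rintro _ ⟨n, rfl⟩
      exact ⟨_, hconst n z₀ hz₀M, hval n z₀ hz₀M⟩
    exact closure_minimal hd hcl (hT _ x)
  obtain ⟨z₁, hz₁M, hz₁⟩ := hsurj
  have hinv : InvS (zA X 0) (M ∩ {z | z (fun _ => 0) = x}) := by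
    refine ⟨hM.1.1.inter (isClosed_eq (continuous_apply _) continuous_const), ⟨z₁, hz₁M, hz₁⟩, ?_⟩
    rintro ⟨n, g, hg⟩ z ⟨hz, hz'⟩
    refine ⟨hM.1.2.2 (n, ⟨g, dF_mono_succ 0 hg⟩) z hz, ?_⟩
    have := dF_zero_iff.1 hg
    subst this
    exact hz'
  obtain ⟨K, hKM, hK⟩ := exists_minS _ hinv
  obtain ⟨z, hz⟩ := hK.1.2.1
  have hO : IsOpen {z : (ℤ → ℤ) → X | z (fun _ => 0) ∈ U ∧ ∀ i, z (fun t => p i (E * t)) ∈ U} := by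
    simp only [ofPred_and, ofPred_forall]
    exact (hU.preimage (continuous_apply _)).inter
      (isOpen_iInter_of_finite fun i => hU.preimage (continuous_apply _))
  obtain ⟨⟨n, g, hg⟩, hng⟩ := hM.exists_mem (zA_id _) (zA_comp _) (zA_continuous _) hO
    ⟨z₀, ⟨hz₀U, hz₀⟩, hz₀M⟩ z (hKM hz).1
  obtain ⟨c, rfl⟩ : ∃ c, g = fun _ => c := ⟨g 0, funext fun t => dF_one hg t⟩
  have hnz : zact 0 (fun _ => c) (zact n (fun _ => 0) z) ∈
      {z : (ℤ → ℤ) → X | z (fun _ => 0) ∈ U ∧ ∀ i, z (fun t => p i (E * t)) ∈ U} := by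
    rw [zact_zact]
    convert hng using 1
    exact zact_congr (by simp) (fun t => by simp) z
  have hKinv : ∀ m : ℤ, zact m (fun _ => 0) z ∈ K := fun m => hK.1.2.2 (m, 0) z hz
  obtain ⟨C, hC⟩ := hK.exists_finset (zA_id _) (zA_comp _) (zA_continuous _)
    (hO.preimage (zact_continuous 0 (fun _ => c))) ⟨_, hnz, hKinv n⟩
  have hx : z (fun _ => 0) = x := (hKM hz).2
  refine ⟨c, ∑ i ∈ C, i.1.natAbs, zact 0 (fun _ => c) z, ⟨zOm_inv T _ _ (hMO (hKM hz).1), ?_, ?_⟩, ?_⟩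
  · refine subset_closure ?_
    have := hnz.1
    simp only [zact, zero_add, add_zero] at this ⊢
    exact this
  · intro m
    obtain ⟨⟨j, g, hg⟩, hjC, hj⟩ := hC _ (hKinv m)
    have := dF_zero_iff.1 hg
    subst this
    refine ⟨j, ?_, fun i => subset_closure ?_⟩
    · have := Finset.single_le_sum (f := fun i : ℤ × dF ℤ 0 => i.1.natAbs)
        (fun i _ => Nat.zero_le _) hjC
      simp only at this
      rw [Finset.mem_Icc]
      omega
    · have := hj.2 i
      simp only [zA, zact, Pi.zero_apply, add_zero] at this ⊢
      convert this using 4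
  · change zact 0 (fun _ => c) z (fun _ => 0) = _
    rw [hval c z (hKM hz).1, hx]

lemma step7 {X : Type*} [TopologicalSpace X] [CompactSpace X] [T2Space X] [Nonempty X]
    (T : X ≃ₜ X) (hT : IsMinimalTDS T) (d : ℕ) (p : Fin d → ℤ → ℤ)
    (hp : ∀ i, p i 0 = 0 ∧ ∃ q : Polynomial ℚ, ∀ n : ℤ, (p i n : ℚ) = q.eval (n : ℚ))
    (U U₁ : Set X) (hU : IsOpen U) (hUne : U.Nonempty) (hU₁ : IsOpen U₁) (hUU : closure U ⊆ U₁) :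
    ∃ E : ℤ, 1 ≤ E ∧ ∃ N : ℕ, ∃ V : Set X, IsOpen V ∧ V.Nonempty ∧ V ⊆ U ∧
      ∀ L : ℕ, V ⊆ closure (zW T p U₁ E N L) := by
  obtain ⟨E, hE, hcov⟩ := step6 T hT d p hp U hU hUne
  let K : ℕ → Set X := fun N => (fun z : (ℤ → ℤ) → X => z (fun _ => 0)) '' zK T p U E N
  have hKc : ∀ N, IsClosed (K N) := fun N =>
    ((zK_closed T p U E N).isCompact.image (continuous_apply _)).isClosed
  obtain ⟨⟨c, N⟩, w, hw⟩ := nonempty_interior_of_iUnion_of_closed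
    (f := fun y : ℤ × ℕ => hpow T y.1 ⁻¹' K y.2)
    (fun y => (hKc y.2).preimage (hpow_continuous T y.1)) (by
      ext x
      simp only [mem_iUnion, mem_univ, iff_true]
      obtain ⟨c, N, h⟩ := hcov x
      exact ⟨(c, N), h⟩)
  have hcc : ∀ y, hpow T c (hpow T (-c) y) = y := by
    intro y; rw [← hpow_add]; simp [hpow_zero]
  have hcc' : ∀ y, hpow T (-c) (hpow T c y) = y := by
    intro y; rw [← hpow_add]; simp [hpow_zero]
  let V₀ := hpow T (-c) ⁻¹' interior (hpow T c ⁻¹' K N)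
  have hV₀ : IsOpen V₀ := isOpen_interior.preimage (hpow_continuous T _)
  have hwV : hpow T c w ∈ V₀ := by
    change hpow T (-c) (hpow T c w) ∈ interior (hpow T c ⁻¹' K N)
    rw [hcc']; exact hw
  have hV₀K : V₀ ⊆ K N := by
    intro y hy
    have := interior_subset hy
    rw [mem_preimage, hcc] at this
    exact this
  have hKU : K N ⊆ closure U := by
    rintro _ ⟨z, hz, rfl⟩
    exact hz.2.1
  refine ⟨E, hE, N, V₀ ∩ U, hV₀.inter hU, ?_, inter_subset_right, fun L x hx => ?_⟩
  · exact mem_closure_iff.1 (hKU (hV₀K hwV)) V₀ hV₀ hwV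
  · rw [mem_closure_iff]
    intro O hO hxO
    obtain ⟨z, ⟨hzO, -, hz⟩, rfl⟩ := hV₀K hx.1
    have hop : IsOpen ((fun z : (ℤ → ℤ) → X => z (fun _ => 0)) ⁻¹' O ∩
        ⋂ n ∈ Finset.Icc (0 : ℤ) L, ⋃ j ∈ Finset.Icc (-(N : ℤ)) N, ⋂ i : Fin d,
        (fun z : (ℤ → ℤ) → X => z (fun t => p i (E * (t + n + j)))) ⁻¹' U₁) :=
      (hO.preimage (continuous_apply _)).inter (isOpen_biInter_finset fun n _ =>
        isOpen_biUnion fun j _ => isOpen_iInter_of_finite fun i =>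
          hU₁.preimage (continuous_apply _))
    obtain ⟨_, hθ, ⟨a, u⟩, rfl⟩ := mem_closure_iff.1 hzO _ hop (by
      refine ⟨hxO, ?_⟩
      simp only [mem_iInter, mem_iUnion]
      intro n _
      obtain ⟨j, hj, h⟩ := hz n
      exact ⟨j, hj, fun i => hUU (h i)⟩)
    refine ⟨u, hθ.1, a, fun n hn => ?_⟩
    have := hθ.2
    simp only [mem_iInter, mem_iUnion] at this
    obtain ⟨j, hj, h⟩ := this n hn
    exact ⟨j, hj, fun i => h i⟩

lemma zW_open {X : Type*} [TopologicalSpace X] (T : X ≃ₜ X) {d : ℕ} (p : Fin d → ℤ → ℤ)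
    (U : Set X) (hU : IsOpen U) (E : ℤ) (N L : ℕ) : IsOpen (zW T p U E N L) := by
  have : zW T p U E N L = ⋃ a : ℤ, ⋂ n ∈ Finset.Icc (0 : ℤ) L,
      ⋃ j ∈ Finset.Icc (-(N : ℤ)) N, ⋂ i : Fin d, hpow T (p i (E * (a + n + j))) ⁻¹' U := by
    ext x
    simp [zW]
  rw [this]
  exact isOpen_iUnion fun a => isOpen_biInter_finset fun n _ =>
    isOpen_biUnion fun j _ => isOpen_iInter_of_finite fun i =>
      hU.preimage (hpow_continuous T _)

lemma win_of_zW {X : Type*} [TopologicalSpace X] (T : X ≃ₜ X) {d : ℕ} (p : Fin d → ℤ → ℤ)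
    (U : Set X) (E : ℤ) (hE : 1 ≤ E) (N : ℕ) (x : X) (hx : ∀ L, x ∈ zW T p U E N L) :
    Win {n : ℤ | ∀ i : Fin d, hpow T (p i n) x ∈ U} := by
  refine ⟨(E * (1 + 2 * N)).toNat, fun L => ?_⟩
  obtain ⟨a, ha⟩ := hx (L + 1 + N)
  refine ⟨E * a, fun k h1 h2 => ?_⟩
  have hE0 : (0 : ℤ) < E := by omega
  set r := (k - E * a) / E with hr
  have hr0 : 0 ≤ r := Int.ediv_nonneg (by omega) (by omega)
  have hrL : r ≤ L := (Int.ediv_le_self _ (by omega)).trans (by omega)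
  have hr1 : E * r ≤ k - E * a := Int.mul_ediv_self_le hE0.ne'
  have hr2 : k - E * a < E * r + E := Int.lt_mul_ediv_self_add hE0
  obtain ⟨j, hj, h⟩ := ha (r + 1 + N) (by rw [Finset.mem_Icc]; push_cast; omega)
  rw [Finset.mem_Icc] at hj
  refine ⟨E * (a + (r + 1 + N) + j), ?_, ?_, h⟩
  · nlinarith
  · have : ((E * (1 + 2 * (N : ℤ))).toNat : ℤ) = E * (1 + 2 * N) :=
      Int.toNat_of_nonneg (by positivity)
    rw [this]
    nlinarith

lemma residual_open {X : Type*} [MetricSpace X] [CompactSpace X] [Nonempty X]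
    (T : X ≃ₜ X) (hT : IsMinimalTDS T) (d : ℕ) (p : Fin d → ℤ → ℤ)
    (hp : ∀ i, p i 0 = 0 ∧ ∃ q : Polynomial ℚ, ∀ n : ℤ, (p i n : ℚ) = q.eval (n : ℚ))
    (U : Set X) (hU : IsOpen U) :
    ∀ᶠ x in residual X, x ∈ U → Win {n : ℤ | ∀ i : Fin d, hpow T (p i n) x ∈ U} := by
  let V : ℤ × ℕ → Set X := fun y => interior (⋂ L : ℕ, closure (zW T p U y.1 y.2 L))
  have h1 : ∀ᶠ x in residual X, ∀ (y : ℤ × ℕ) (L : ℕ), x ∈ V y → x ∈ zW T p U y.1 y.2 L := by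
    rw [eventually_countable_forall]
    intro y
    rw [eventually_countable_forall]
    intro L
    have hW := zW_open T p U hU y.1 y.2 L
    have : zW T p U y.1 y.2 L ∪ (closure (zW T p U y.1 y.2 L))ᶜ ∈ residual X := by
      refine residual_of_dense_open (hW.union isClosed_closure.isOpen_compl) ?_
      intro x
      by_cases hx : x ∈ closure (zW T p U y.1 y.2 L)
      · exact closure_mono subset_union_left hx
      · exact subset_closure (Or.inr hx)
    filter_upwards [this] with x hx hxV
    rcases hx with hx | hx
    · exact hx
    · exact absurd (mem_iInter.1 (interior_subset hxV) L) hx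
  have h2 : (⋃ y ∈ {y : ℤ × ℕ | 1 ≤ y.1}, V y) ∪ (closure U)ᶜ ∈ residual X := by
    refine residual_of_dense_open ((isOpen_biUnion fun _ _ => isOpen_interior).union
      isClosed_closure.isOpen_compl) ?_
    intro x
    rw [mem_closure_iff]
    intro O hO hxO
    by_cases hx : x ∈ closure U
    swap
    · exact ⟨x, hxO, Or.inr hx⟩
    obtain ⟨u, huO, huU⟩ := mem_closure_iff.1 hx O hO hxO
    obtain ⟨ε, hε, hb⟩ := Metric.isOpen_iff.1 (hO.inter hU) u ⟨huO, huU⟩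
    have hcb : closure (Metric.ball u (ε / 2)) ⊆ O ∩ U :=
      Metric.closure_ball_subset_closedBall.trans
        ((Metric.closedBall_subset_ball (by linarith)).trans hb)
    obtain ⟨E, hE, N, W, hW, ⟨w, hw⟩, hWU, hWL⟩ := step7 T hT d p hp (Metric.ball u (ε / 2)) U
      Metric.isOpen_ball ⟨u, Metric.mem_ball_self (by linarith)⟩ hU
      (hcb.trans inter_subset_right)
    refine ⟨w, (hcb (subset_closure (hWU hw))).1, Or.inl ?_⟩
    simp only [mem_iUnion]
    exact ⟨(E, N), hE, interior_maximal (subset_iInter hWL) hW hw⟩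
  filter_upwards [h1, h2] with x hx1 hx2 hxU
  rcases hx2 with hx2 | hx2
  · simp only [mem_iUnion] at hx2
    obtain ⟨y, hy, hxy⟩ := hx2
    exact win_of_zW T p U y.1 hy y.2 x fun L => hx1 y L hxy
  · exact absurd (subset_closure hxU) hx2

/-- **Corollary.** Let `(X,T)` be a minimal **distal** t.d.s. and `p 0, …, p (d-1)`
integral polynomials with `p i 0 = 0`. Then there is a dense `Gδ` subset `X₀` such that
for each `x ∈ X₀` and each neighbourhood `U` of `x`, the set
`N(x,U) = {n ∈ ℤ : T^{p i (n)} x ∈ U ∀ i}` is piecewise syndetic. -/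
theorem polynomial_return_times_piecewise_syndetic_distal
    {X : Type*} [MetricSpace X] [CompactSpace X] (T : X ≃ₜ X) (hT : IsMinimalTDS T)
    (hdistal : ∀ x y : X, x ≠ y →
      ∃ ε : ℝ, 0 < ε ∧ ∀ n : ℤ, ε ≤ dist (hpow T n x) (hpow T n y))
    (d : ℕ) (p : Fin d → ℤ → ℤ)
    (hp : ∀ i, p i 0 = 0 ∧ ∃ q : Polynomial ℚ, ∀ n : ℤ, (p i n : ℚ) = q.eval (n : ℚ)) :
    ∃ X₀ : Set X, IsGδ X₀ ∧ Dense X₀ ∧ ∀ x ∈ X₀, ∀ U ∈ 𝓝 x,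
      PiecewiseSyndetic {n : ℤ | ∀ i : Fin d, hpow T (p i n) x ∈ U} := by
  rcases isEmpty_or_nonempty X with hX | hX
  · exact ⟨univ, IsGδ.univ, dense_univ, fun x => (hX.false x).elim⟩
  have hall : ∀ᶠ x in residual X, ∀ b ∈ TopologicalSpace.countableBasis X,
      x ∈ b → Win {n : ℤ | ∀ i : Fin d, hpow T (p i n) x ∈ b} := by
    rw [eventually_countable_ball (TopologicalSpace.countable_countableBasis X)]
    intro b hb
    exact residual_open T hT d p hp b (TopologicalSpace.isOpen_of_mem_countableBasis hb)
  obtain ⟨X₀, hsub, hG, hD⟩ := mem_residual.1 hall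
  refine ⟨X₀, hG, hD, fun x hx U hU => ?_⟩
  obtain ⟨b, hb, hxb, hbU⟩ :=
    (TopologicalSpace.isBasis_countableBasis X).mem_nhds_iff.1 hU
  have hsubset : {n : ℤ | ∀ i : Fin d, hpow T (p i n) x ∈ b} ⊆
      {n : ℤ | ∀ i : Fin d, hpow T (p i n) x ∈ U} := fun n hn i => hbU (hn i)
  exact ((hsub hx b hb hxb).mono hsubset).ps
end

section
/- Let π : (X,T) → (Y,S) be a factor map between topological dynamical systems. Then there exists a commutative diagram of factor maps τ : (X',T') → (X,T), θ : (Y',S') → (Y,S), π' : (X',T') → (Y',S') with π ∘ τ = θ ∘ π', such that (1) τ and θ are almost one to one extensions, and (2) the phase spaces X' and Y' are zero dimensional. If in addition (X,T) is minimal, then (X',T') and (Y',S') are minimal. -/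
open Filter Topology Function Set

/-- A continuous surjection intertwining the dynamics is almost one to one if the points
with singleton fibre over their image form a dense `Gδ` subset of the domain. -/
def AlmostOneToOne {A B : Type*} [TopologicalSpace A] [TopologicalSpace B] (f : A → B) : Prop :=
  ∃ A₀ : Set A, IsGδ A₀ ∧ Dense A₀ ∧ ∀ a ∈ A₀, f ⁻¹' {f a} = {a}

/-! ### Iterates -/

theorem hpowNat_eq_pow {X : Type*} [TopologicalSpace X] (T : X ≃ₜ X) (n : ℕ) :
    hpowNat T n = T ^ n := by
  induction n with
  | zero => rfl
  | succ n ih => rw [pow_succ', ← ih]; rfl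

theorem hpow_eq_zpow {X : Type*} [TopologicalSpace X] (T : X ≃ₜ X) (n : ℤ) :
    hpow T n = ⇑(T ^ n) := by
  cases n with
  | ofNat n =>
    change ⇑(hpowNat T n) = _
    rw [hpowNat_eq_pow, Int.ofNat_eq_natCast, zpow_natCast]
  | negSucc n =>
    change ⇑(hpowNat T (n + 1)).symm = _
    rw [hpowNat_eq_pow, zpow_negSucc]
    rfl

theorem zpow_succ_apply {X : Type*} [TopologicalSpace X] (T : X ≃ₜ X) (n : ℤ) (x : X) :
    (T ^ (n + 1)) x = (T ^ n) (T x) := by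
  rw [zpow_add_one]; rfl

theorem zpow_semiconj {X Y : Type*} [TopologicalSpace X] [TopologicalSpace Y]
    (T : X ≃ₜ X) (S : Y ≃ₜ Y) (f : X → Y) (hf : ∀ x, f (T x) = S (f x)) (n : ℤ) :
    ∀ x, f ((T ^ n) x) = (S ^ n) (f x) := by
  induction n using Int.induction_on with
  | zero => intro x; rfl
  | succ n ih => intro x; rw [zpow_succ_apply, zpow_succ_apply, ih, hf]
  | pred n ih =>
    intro x
    have h1 := zpow_succ_apply T (-(n : ℤ) - 1) (T.symm x)
    have h2 := zpow_succ_apply S (-(n : ℤ) - 1) (f (T.symm x))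
    rw [sub_add_cancel, T.apply_symm_apply] at h1
    rw [sub_add_cancel, ← hf, T.apply_symm_apply] at h2
    rw [← h1, ← h2, ih]

theorem image_zorbit {X Y : Type*} [TopologicalSpace X] [TopologicalSpace Y]
    (T : X ≃ₜ X) (S : Y ≃ₜ Y) (f : X → Y) (hf : ∀ x, f (T x) = S (f x)) (x : X) :
    f '' zorbit T x = zorbit S (f x) := by
  unfold zorbit
  rw [← range_comp]
  congr 1
  ext n
  simp only [comp_apply, hpow_eq_zpow, zpow_semiconj T S f hf]

/-! ### Almost one to one maps -/

theorem AlmostOneToOne.eq_univ {A B : Type*} [TopologicalSpace A] [TopologicalSpace B] {f : A → B}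
    (hf : AlmostOneToOne f) {P : Set A} (hP : IsClosed P) (h : f '' P = univ) : P = univ := by
  obtain ⟨A₀, -, hd, h1⟩ := hf
  rw [← hP.closure_eq]
  refine (hd.mono ?_).closure_eq
  intro a ha
  obtain ⟨b, hb, hba⟩ : f a ∈ f '' P := h ▸ mem_univ _
  have : b ∈ f ⁻¹' {f a} := hba
  rw [h1 a ha] at this
  rwa [← (this : b = a)]

theorem AlmostOneToOne.minimal {A B : Type*} [TopologicalSpace A] [TopologicalSpace B]
    [CompactSpace A] [T2Space B] {f : A → B}
    (hf : AlmostOneToOne f) (hc : Continuous f) (T' : A ≃ₜ A) (T : B ≃ₜ B)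
    (hT : ∀ a, f (T' a) = T (f a)) (hm : IsMinimalTDS T) : IsMinimalTDS T' := by
  intro a
  rw [dense_iff_closure_eq]
  refine hf.eq_univ isClosed_closure ?_
  have hcl : IsClosed (f '' closure (zorbit T' a)) := (isClosed_closure.isCompact.image hc).isClosed
  rw [← hcl.closure_eq]
  refine ((hm (f a)).mono ?_).closure_eq
  rw [← image_zorbit T' T f hT]
  exact image_mono subset_closure

/-! ### Coding -/

section Coding

variable {J Z : Type*}

/-- `a` is an admissible code of `x`. -/
def CodeRel (H : J → Z → ℝ) (x : Z) (a : J → Bool) : Prop :=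
  ∀ j, (a j = true → 0 ≤ H j x) ∧ (a j = false → H j x ≤ 0)

/-- Generic points. -/
def Gen (H : J → Z → ℝ) : Set Z := {x | ∀ j, H j x ≠ 0}

open Classical in
/-- The code of a point. -/
noncomputable def code (H : J → Z → ℝ) (x : Z) : J → Bool := fun j => decide (0 ≤ H j x)

/-- The code space. -/
def CS (H : J → Z → ℝ) : Set (J → Bool) := closure (code H '' Gen H)

theorem rel_code (H : J → Z → ℝ) (x : Z) : CodeRel H x (code H x) := by
  intro j
  simp only [code, decide_eq_true_eq, decide_eq_false_iff_not, not_le]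
  exact ⟨id, le_of_lt⟩

theorem eq_code {H : J → Z → ℝ} {x : Z} (hx : x ∈ Gen H) {a : J → Bool} (h : CodeRel H x a) :
    a = code H x := by
  ext j
  have := hx j
  cases haj : a j with
  | true => simpa [code] using (h j).1 haj
  | false => simpa [code] using lt_of_le_of_ne ((h j).2 haj) this

theorem rel_unique {H : J → Z → ℝ}
    (hs : ∀ x y, x ≠ y → ∃ j, (H j x < 0 ∧ 0 < H j y) ∨ (H j y < 0 ∧ 0 < H j x))
    {x y : Z} {a : J → Bool} (hx : CodeRel H x a) (hy : CodeRel H y a) : x = y := by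
  by_contra hne
  obtain ⟨j, hj⟩ := hs x y hne
  cases haj : a j with
  | true =>
    have h1 := (hx j).1 haj
    have h2 := (hy j).1 haj
    rcases hj with hj | hj <;> linarith
  | false =>
    have h1 := (hx j).2 haj
    have h2 := (hy j).2 haj
    rcases hj with hj | hj <;> linarith

variable [TopologicalSpace Z]

theorem isClosed_rel {H : J → Z → ℝ} (hc : ∀ j, Continuous (H j)) :
    IsClosed {p : Z × (J → Bool) | CodeRel H p.1 p.2} := by
  have hb : ∀ (j : J) (b : Bool), IsOpen {p : Z × (J → Bool) | p.2 j = b} := fun j b =>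
    (isOpen_discrete {b}).preimage
      (show Continuous fun p : Z × (J → Bool) => p.2 j by fun_prop)
  simp only [CodeRel, ofPred_forall, ofPred_and]
  refine isClosed_iInter fun j => IsClosed.inter ?_ ?_
  · exact isClosed_imp (hb j true) (isClosed_le continuous_const ((hc j).comp continuous_fst))
  · exact isClosed_imp (hb j false) (isClosed_le ((hc j).comp continuous_fst) continuous_const)

variable [CompactSpace Z]

theorem exists_rel {H : J → Z → ℝ} (hc : ∀ j, Continuous (H j)) {a : J → Bool} (ha : a ∈ CS H) :
    ∃ x, CodeRel H x a := by
  have hcl := isClosedMap_snd_of_compactSpace _ (isClosed_rel hc)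
  have : CS H ⊆ Prod.snd '' {p : Z × (J → Bool) | CodeRel H p.1 p.2} := by
    refine closure_minimal ?_ hcl
    rintro _ ⟨x, -, rfl⟩
    exact ⟨(x, code H x), rel_code H x, rfl⟩
  obtain ⟨⟨x, b⟩, h, rfl⟩ := this ha
  exact ⟨x, h⟩

theorem dense_gen [Countable J] [BaireSpace Z] {H : J → Z → ℝ} (hc : ∀ j, Continuous (H j))
    (h0 : ∀ j, interior {x | H j x = 0} = ∅) : IsGδ (Gen H) ∧ Dense (Gen H) := by
  have ho : ∀ j, IsOpen {x | H j x ≠ 0} := fun j => isOpen_ne_fun (hc j) continuous_const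
  have : Gen H = ⋂ j, {x | H j x ≠ 0} := by ext; simp [Gen]
  rw [this]
  refine ⟨IsGδ.iInter_of_isOpen ho, dense_iInter_of_isOpen ho fun j => ?_⟩
  exact interior_eq_empty_iff_dense_compl.1 (h0 j)

/-- The factor map from the code space. -/
theorem exists_tau [Countable J] [BaireSpace Z] [T2Space Z]
    {H : J → Z → ℝ} (hc : ∀ j, Continuous (H j))
    (h0 : ∀ j, interior {x | H j x = 0} = ∅)
    (hs : ∀ x y, x ≠ y → ∃ j, (H j x < 0 ∧ 0 < H j y) ∨ (H j y < 0 ∧ 0 < H j x)) :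
    ∃ τ : CS H → Z, (∀ a, CodeRel H (τ a) a.1) ∧ Continuous τ ∧ Surjective τ ∧ AlmostOneToOne τ := by
  choose τ hτ using fun a : CS H => exists_rel hc a.2
  obtain ⟨hG, hD⟩ := dense_gen hc h0
  have hcont : Continuous τ := by
    rw [continuous_iff_isClosed]
    intro C hC
    have hcl := isClosedMap_snd_of_compactSpace _
      ((isClosed_rel hc).inter (hC.preimage continuous_fst))
    have := hcl.preimage (continuous_subtype_val (p := fun a => a ∈ CS H))
    convert this using 1
    ext a
    constructor
    · intro h
      exact ⟨(τ a, a.1), ⟨hτ a, h⟩, rfl⟩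
    · rintro ⟨⟨x, b⟩, ⟨h1, h2⟩, rfl⟩
      have : τ a = x := rel_unique hs (hτ a) h1
      change τ a ∈ C
      rw [this]; exact h2
  have hcode : ∀ (x : Z) (hx : x ∈ Gen H), τ ⟨code H x, subset_closure ⟨x, hx, rfl⟩⟩ = x :=
    fun x hx => rel_unique hs (hτ _) (rel_code H x)
  have : CompactSpace (CS H) := isCompact_iff_compactSpace.1 isClosed_closure.isCompact
  refine ⟨τ, hτ, hcont, ?_, τ ⁻¹' Gen H, hG.preimage hcont, ?_, ?_⟩
  · rw [← range_eq_univ, ← (isCompact_range hcont).isClosed.closure_eq]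
    exact (hD.mono (s₂ := range τ) fun x hx => ⟨_, hcode x hx⟩).closure_eq
  · intro a
    rw [closure_subtype]
    refine closure_mono ?_ a.2
    rintro _ ⟨x, hx, rfl⟩
    refine ⟨⟨code H x, subset_closure ⟨x, hx, rfl⟩⟩, ?_, rfl⟩
    change τ _ ∈ Gen H
    rw [hcode x hx]; exact hx
  · intro a ha
    ext b
    simp only [mem_preimage, mem_singleton_iff]
    refine ⟨fun h => ?_, fun h => h ▸ rfl⟩
    apply Subtype.ext
    rw [eq_code ha (hτ a)]
    have hb := hτ b
    rw [h] at hb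
    exact eq_code ha hb

end Coding

/-! ### Shift -/

section Shift

variable {ι Z : Type*} [TopologicalSpace Z]

/-- Functions along the orbit. -/
def orb (T : Z ≃ₜ Z) (h : ι → Z → ℝ) : ℤ × ι → Z → ℝ := fun p x => h p.2 ((T ^ p.1) x)

/-- The shift. -/
def shift (ι : Type*) : (ℤ × ι → Bool) ≃ₜ (ℤ × ι → Bool) where
  toFun a := fun p => a (p.1 + 1, p.2)
  invFun a := fun p => a (p.1 - 1, p.2)
  left_inv a := by ext p; simp
  right_inv a := by ext p; simp
  continuous_toFun := by fun_prop
  continuous_invFun := by fun_prop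

theorem shift_apply (a : ℤ × ι → Bool) (p : ℤ × ι) : shift ι a p = a (p.1 + 1, p.2) := rfl

theorem orb_apply (T : Z ≃ₜ Z) (h : ι → Z → ℝ) (p : ℤ × ι) (x : Z) :
    orb T h p (T x) = orb T h (p.1 + 1, p.2) x := by
  simp only [orb, zpow_succ_apply]

theorem shift_code (T : Z ≃ₜ Z) (h : ι → Z → ℝ) (x : Z) :
    shift ι (code (orb T h) x) = code (orb T h) (T x) := by
  ext p
  simp only [shift_apply, code, orb_apply]

theorem rel_shift (T : Z ≃ₜ Z) (h : ι → Z → ℝ) {x : Z} {a : ℤ × ι → Bool}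
    (hr : CodeRel (orb T h) x a) : CodeRel (orb T h) (T x) (shift ι a) := by
  intro p
  rw [orb_apply, shift_apply]
  exact hr _

theorem gen_iff (T : Z ≃ₜ Z) (h : ι → Z → ℝ) (x : Z) :
    T x ∈ Gen (orb T h) ↔ x ∈ Gen (orb T h) := by
  constructor
  · intro hx p
    have := hx (p.1 - 1, p.2)
    rw [orb_apply] at this
    simpa using this
  · intro hx p
    rw [orb_apply]
    exact hx _

theorem mem_CS_iff (T : Z ≃ₜ Z) (h : ι → Z → ℝ) (a : ℤ × ι → Bool) :
    a ∈ CS (orb T h) ↔ shift ι a ∈ CS (orb T h) := by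
  unfold CS
  rw [← mem_preimage (f := shift ι), (shift ι).preimage_closure]
  have : shift ι ⁻¹' (code (orb T h) '' Gen (orb T h)) = code (orb T h) '' Gen (orb T h) := by
    ext b
    constructor
    · rintro ⟨y, hy, hyb⟩
      refine ⟨T.symm y, ?_, ?_⟩
      · rw [← gen_iff]; simpa using hy
      · apply (shift ι).injective
        rw [shift_code, T.apply_symm_apply, hyb]
    · rintro ⟨y, hy, rfl⟩
      exact ⟨T y, (gen_iff T h y).2 hy, (shift_code T h y).symm⟩
  rw [this]

/-- Shift on the code space. -/
def shiftCS (T : Z ≃ₜ Z) (h : ι → Z → ℝ) : CS (orb T h) ≃ₜ CS (orb T h) :=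
  (shift ι).subtype (mem_CS_iff T h)

theorem shiftCS_val (T : Z ≃ₜ Z) (h : ι → Z → ℝ) (a : CS (orb T h)) :
    (shiftCS T h a).1 = shift ι a.1 := rfl

theorem orb_continuous (T : Z ≃ₜ Z) {h : ι → Z → ℝ} (hc : ∀ i, Continuous (h i)) (p : ℤ × ι) :
    Continuous (orb T h p) := (hc p.2).comp (T ^ p.1).continuous

theorem orb_interior (T : Z ≃ₜ Z) {h : ι → Z → ℝ} (h0 : ∀ i, interior {x | h i x = 0} = ∅)
    (p : ℤ × ι) : interior {x | orb T h p x = 0} = ∅ := by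
  have : {x | orb T h p x = 0} = (T ^ p.1) ⁻¹' {x | h p.2 x = 0} := rfl
  rw [this, ← Homeomorph.preimage_interior, h0, preimage_empty]

theorem orb_sep (T : Z ≃ₜ Z) {h : ι → Z → ℝ}
    (hs : ∀ x y, x ≠ y → ∃ j, (h j x < 0 ∧ 0 < h j y) ∨ (h j y < 0 ∧ 0 < h j x)) :
    ∀ x y, x ≠ y → ∃ j, (orb T h j x < 0 ∧ 0 < orb T h j y) ∨
      (orb T h j y < 0 ∧ 0 < orb T h j x) := by
  intro x y hxy
  obtain ⟨j, hj⟩ := hs x y hxy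
  exact ⟨(0, j), hj⟩

end Shift

/-! ### Good families of functions -/

theorem exists_good_value {X : Type*} [TopologicalSpace X] [TopologicalSpace.SeparableSpace X]
    (f : X → ℝ) (p q : ℝ) (hpq : p < q) : ∃ c ∈ Ioo p q, interior {x | f x = c} = ∅ := by
  have hcount : {c | (interior {x | f x = c}).Nonempty}.Countable := by
    refine Set.PairwiseDisjoint.countable_of_isOpen (s := fun c => interior {x | f x = c}) ?_
      (fun _ _ => isOpen_interior) (fun _ h => h)
    intro c _ d _ hcd
    refine Set.disjoint_left.2 fun x hx hy => hcd ?_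
    have h1 : f x = c := interior_subset (s := {x | f x = c}) hx
    have h2 : f x = d := interior_subset (s := {x | f x = d}) hy
    exact h1.symm.trans h2
  obtain ⟨c, hc, hc'⟩ := (hcount.dense_compl ℝ).exists_mem_open isOpen_Ioo (nonempty_Ioo.2 hpq)
  exact ⟨c, hc', not_nonempty_iff_eq_empty.1 hc⟩

theorem exists_family {X Y : Type*} [TopologicalSpace X] [TopologicalSpace.SeparableSpace X]
    [MetricSpace Y] [CompactSpace Y] (π : X → Y) :
    ∃ (ι : Type) (_ : Countable ι) (h : ι → Y → ℝ), (∀ i, Continuous (h i)) ∧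
      (∀ i, interior {x | h i (π x) = 0} = ∅) ∧
      ∀ x y, x ≠ y → ∃ j, (h j x < 0 ∧ 0 < h j y) ∨ (h j y < 0 ∧ 0 < h j x) := by
  rcases isEmpty_or_nonempty Y with hY | hY
  · exact ⟨Empty, inferInstance, fun i => i.elim, fun i => i.elim, fun i => i.elim,
      fun x => (hY.false x).elim⟩
  let d := TopologicalSpace.denseSeq Y
  have hd : DenseRange d := TopologicalSpace.denseRange_denseSeq Y
  choose c hc hc0 using fun i : ℕ × {r : ℚ × ℚ // r.1 < r.2} =>
    exists_good_value (fun x => dist (π x) (d i.1)) (i.2.1.1 : ℝ) (i.2.1.2 : ℝ)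
      (by exact_mod_cast i.2.2)
  refine ⟨ℕ × {r : ℚ × ℚ // r.1 < r.2}, inferInstance, fun i y => dist y (d i.1) - c i,
    fun i => by fun_prop, fun i => by simpa only [sub_eq_zero] using hc0 i, ?_⟩
  intro x y hxy
  obtain ⟨n, hn⟩ := hd.exists_dist_lt x (half_pos (dist_pos.2 hxy))
  have hlt : dist x (d n) < dist y (d n) := by
    have := dist_triangle_right x y (d n)
    linarith
  obtain ⟨p, hp1, hp2⟩ := exists_rat_btwn hlt
  obtain ⟨q, hq1, hq2⟩ := exists_rat_btwn hp2
  have hpq : p < q := by exact_mod_cast hq1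
  refine ⟨(n, ⟨(p, q), hpq⟩), Or.inl ?_⟩
  have := hc (n, ⟨(p, q), hpq⟩)
  simp only [mem_Ioo] at this
  constructor <;> simp only <;> linarith [this.1, this.2]

/-- **Theorem 5.1.** Every factor map `π : (X,T) → (Y,S)` between t.d.s. fits into a
commutative diagram with factor maps `τ : (X',T') → (X,T)`, `θ : (Y',S') → (Y,S)` and
`π' : (X',T') → (Y',S')` such that `π ∘ τ = θ ∘ π'`, `τ` and `θ` are almost one to one,
and `X'`, `Y'` are zero dimensional. If `(X,T)` is minimal then `(X',T')` and `(Y',S')`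
are minimal. -/
theorem zero_dimensional_extension_of_factor_map
    {X Y : Type*} [MetricSpace X] [CompactSpace X] [MetricSpace Y] [CompactSpace Y]
    (T : X ≃ₜ X) (S : Y ≃ₜ Y) (π : X → Y)
    (hπc : Continuous π) (hπs : Surjective π) (hπT : ∀ x, π (T x) = S (π x)) :
    ∃ (X' : Type) (_ : MetricSpace X') (_ : CompactSpace X')
      (Y' : Type) (_ : MetricSpace Y') (_ : CompactSpace Y')
      (T' : X' ≃ₜ X') (S' : Y' ≃ₜ Y') (τ : X' → X) (θ : Y' → Y) (π' : X' → Y'),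
      Continuous τ ∧ Surjective τ ∧ (∀ x', τ (T' x') = T (τ x')) ∧
      Continuous θ ∧ Surjective θ ∧ (∀ y', θ (S' y') = S (θ y')) ∧
      Continuous π' ∧ Surjective π' ∧ (∀ x', π' (T' x') = S' (π' x')) ∧
      (∀ x', π (τ x') = θ (π' x')) ∧
      AlmostOneToOne τ ∧ AlmostOneToOne θ ∧
      TopologicalSpace.IsTopologicalBasis {s : Set X' | IsClopen s} ∧
      TopologicalSpace.IsTopologicalBasis {s : Set Y' | IsClopen s} ∧
      (IsMinimalTDS T → IsMinimalTDS T' ∧ IsMinimalTDS S') := by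
  obtain ⟨β, _, f, hfc, hf0, hfs⟩ := exists_family π
  obtain ⟨α, _, g, hgc, hg0, hgs⟩ := exists_family (id : X → X)
  have hf0' : ∀ i, interior {y | f i y = 0} = ∅ := by
    intro i
    rw [eq_empty_iff_forall_notMem]
    intro y hy
    obtain ⟨x, rfl⟩ := hπs y
    have : x ∈ interior {x | f i (π x) = 0} :=
      mem_interior.2 ⟨π ⁻¹' interior {y | f i y = 0}, fun z hz => interior_subset (s := {y | f i y = 0}) hz,
        isOpen_interior.preimage hπc, hy⟩
    rw [hf0 i] at this
    exact this
  let h : α ⊕ β → X → ℝ := Sum.elim g (fun b x => f b (π x))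
  have hhc : ∀ i, Continuous (h i) := by
    rintro (i | i)
    · exact hgc i
    · exact (hfc i).comp hπc
  have hh0 : ∀ i, interior {x | h i x = 0} = ∅ := by
    rintro (i | i)
    · exact hg0 i
    · exact hf0 i
  have hhs : ∀ x y, x ≠ y → ∃ j, (h j x < 0 ∧ 0 < h j y) ∨ (h j y < 0 ∧ 0 < h j x) := by
    intro x y hxy
    obtain ⟨j, hj⟩ := hgs x y hxy
    exact ⟨Sum.inl j, hj⟩
  obtain ⟨τ, hτr, hτc, hτs, hτa⟩ := exists_tau (orb_continuous T hhc) (orb_interior T hh0)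
    (orb_sep T hhs)
  obtain ⟨θ, hθr, hθc, hθs, hθa⟩ := exists_tau (orb_continuous S hfc) (orb_interior S hf0')
    (orb_sep S hfs)
  have horb : ∀ k b x, orb T h (k, Sum.inr b) x = orb S f (k, b) (π x) := by
    intro k b x
    change f b (π ((T ^ k) x)) = f b ((S ^ k) (π x))
    rw [zpow_semiconj T S π hπT]
  let ρ : (ℤ × (α ⊕ β) → Bool) → (ℤ × β → Bool) := fun a p => a (p.1, Sum.inr p.2)
  have hρc : Continuous ρ := by fun_prop
  have hρm : MapsTo ρ (CS (orb T h)) (CS (orb S f)) := by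
    refine MapsTo.closure ?_ hρc
    rintro _ ⟨x, hx, rfl⟩
    refine ⟨π x, ?_, ?_⟩
    · rintro ⟨k, b⟩
      rw [← horb]
      exact hx _
    · ext ⟨k, b⟩
      simp only [ρ, code, horb]
  let π' : CS (orb T h) → CS (orb S f) := hρm.restrict
  have hπ'c : Continuous π' := hρc.restrict hρm
  have hcomm : ∀ a, π (τ a) = θ (π' a) := by
    intro a
    refine rel_unique (orb_sep S hfs) (a := (π' a).1) ?_ (hθr _)
    rintro ⟨k, b⟩
    rw [← horb]
    exact hτr a (k, Sum.inr b)
  have hcX : CompactSpace (CS (orb T h)) := isCompact_iff_compactSpace.1 isClosed_closure.isCompact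
  have hcY : CompactSpace (CS (orb S f)) := isCompact_iff_compactSpace.1 isClosed_closure.isCompact
  have hπ's : Surjective π' := by
    rw [← range_eq_univ]
    refine hθa.eq_univ (isCompact_range hπ'c).isClosed ?_
    rw [← range_comp, range_eq_univ]
    have : θ ∘ π' = π ∘ τ := funext fun a => (hcomm a).symm
    rw [this]
    exact hπs.comp hτs
  have hτT : ∀ a, τ (shiftCS T h a) = T (τ a) := fun a =>
    rel_unique (orb_sep T hhs) (hτr _) (rel_shift T h (hτr a))
  have hθS : ∀ a, θ (shiftCS S f a) = S (θ a) := fun a =>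
    rel_unique (orb_sep S hfs) (hθr _) (rel_shift S f (hθr a))
  have hπ'T : ∀ a, π' (shiftCS T h a) = shiftCS S f (π' a) := fun a => rfl
  refine ⟨CS (orb T h), TopologicalSpace.metrizableSpaceMetric _, hcX,
    CS (orb S f), TopologicalSpace.metrizableSpaceMetric _, hcY,
    shiftCS T h, shiftCS S f, τ, θ, π', hτc, hτs, hτT, hθc, hθs, hθS, hπ'c, hπ's, hπ'T, hcomm,
    hτa, hθa, isTopologicalBasis_isClopen, isTopologicalBasis_isClopen, ?_⟩
  intro hm
  have hm' : IsMinimalTDS (shiftCS T h) := hτa.minimal hτc _ T hτT hm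
  refine ⟨hm', fun b => ?_⟩
  obtain ⟨a, rfl⟩ := hπ's b
  rw [← image_zorbit (shiftCS T h) (shiftCS S f) π' hπ'T]
  exact hπ's.denseRange.dense_image hπ'c (hm' a)
end
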